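/- Let A, B ⊆ ℝⁿ be closed and disjoint, with ℝⁿ∖A nonempty and interior A nonempty. Let ω : [0,∞) → ℝⁿ be continuous and 0 ≤ t ≤ T. For ε > 0 set τ_ε := min(τ_{A_ε ∪ B}(ω,t), T), and set τ̄ := min(τ_{A ∪ B}(ω,t), T). Assume τ_{interior A}(ω,t) = τ_A(ω,t) and τ_A(ω,t) ≠ T. Then ℓ_ε(ω(τ_ε)) → 1_A(ω(τ̄)) as ε → 0⁺, where 1_A denotes the real-valued indicator of A. (Pathwise convergence underlying Theorem 5.1: V(t,x) = lim_{ε↓0} V_ε(t,x) on the set of paths that enter the interior of A whenever they enter A and do not first hit A exactly at time T.) -/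

import Mathlib

open scoped ENNReal NNReal

/-- First entry time after `t` of the path `ω` into the set `S`, valued in `[0,∞]`
(with `inf ∅ = ∞`). -/
noncomputable def entryTime {n : ℕ} (ω : ℝ≥0 → EuclideanSpace ℝ (Fin n)) (t : ℝ≥0)
    (S : Set (EuclideanSpace ℝ (Fin n))) : ℝ≥0∞ :=
  ⨅ s ∈ {s : ℝ≥0 | t ≤ s ∧ ω s ∈ S}, (s : ℝ≥0∞)

/-- The inner `ε`-approximation `A_ε = {x ∈ A : dist(x, Aᶜ) ≥ ε}`. -/
def innerApprox {n : ℕ} (A : Set (EuclideanSpace ℝ (Fin n))) (ε : ℝ) :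
    Set (EuclideanSpace ℝ (Fin n)) :=
  {x ∈ A | ε ≤ Metric.infDist x Aᶜ}

/-- The payoff `ℓ_ε(x) = max(1 - dist(x, A_ε)/ε, 0)`. -/
noncomputable def payoff {n : ℕ} (A : Set (EuclideanSpace ℝ (Fin n))) (ε : ℝ)
    (x : EuclideanSpace ℝ (Fin n)) : ℝ :=
  max (1 - Metric.infDist x (innerApprox A ε) / ε) 0

open Set Filter Topology Metric

section EntryTime

variable {n : ℕ} {ω : ℝ≥0 → EuclideanSpace ℝ (Fin n)} {t : ℝ≥0}
  {S S' : Set (EuclideanSpace ℝ (Fin n))}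

lemma entryTime_le {s : ℝ≥0} (hts : t ≤ s) (hs : ω s ∈ S) : entryTime ω t S ≤ s :=
  iInf₂_le s ⟨hts, hs⟩

lemma le_entryTime_self : (t : ℝ≥0∞) ≤ entryTime ω t S :=
  le_iInf₂ fun _ hs => ENNReal.coe_le_coe.2 hs.1

lemma entryTime_anti (h : S ⊆ S') : entryTime ω t S' ≤ entryTime ω t S :=
  le_iInf₂ fun _ hs => entryTime_le hs.1 (h hs.2)

lemma entryTime_union :
    entryTime ω t (S ∪ S') = min (entryTime ω t S) (entryTime ω t S') := by
  apply le_antisymm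
  · exact le_min (entryTime_anti subset_union_left) (entryTime_anti subset_union_right)
  · refine le_iInf₂ fun s hs => ?_
    rcases hs.2 with h | h
    · exact (min_le_left _ _).trans (entryTime_le hs.1 h)
    · exact (min_le_right _ _).trans (entryTime_le hs.1 h)

lemma exists_mem_of_entryTime_lt {a : ℝ≥0∞} (h : entryTime ω t S < a) :
    ∃ s : ℝ≥0, t ≤ s ∧ ω s ∈ S ∧ (s : ℝ≥0∞) < a := by
  simp only [entryTime, iInf_lt_iff] at h
  obtain ⟨s, hs, hsa⟩ := h
  exact ⟨s, hs.1, hs.2, hsa⟩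

/-- A continuous path that reaches a closed set is in that set at its entry time. -/
lemma mem_of_entryTime_ne_top (hω : Continuous ω) (hS : IsClosed S)
    (h : entryTime ω t S ≠ ∞) : ω (entryTime ω t S).toNNReal ∈ S := by
  have hne : {s : ℝ≥0 | t ≤ s ∧ ω s ∈ S}.Nonempty := by
    obtain ⟨s, hts, hs, -⟩ := exists_mem_of_entryTime_lt (lt_top_iff_ne_top.2 h)
    exact ⟨s, hts, hs⟩
  have hcl : IsClosed {s : ℝ≥0 | t ≤ s ∧ ω s ∈ S} := isClosed_Ici.inter (hS.preimage hω)
  have hEq : entryTime ω t S = (sInf {s : ℝ≥0 | t ≤ s ∧ ω s ∈ S} : ℝ≥0) :=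
    (ENNReal.coe_sInf hne).symm
  rw [hEq, ENNReal.toNNReal_coe]
  exact (hcl.csInf_mem hne (OrderBot.bddBelow _)).2

end EntryTime

section InnerApprox

variable {n : ℕ} {A : Set (EuclideanSpace ℝ (Fin n))} {ε : ℝ} {x : EuclideanSpace ℝ (Fin n)}

lemma innerApprox_subset : innerApprox A ε ⊆ A := fun _ h => h.1

lemma isClosed_innerApprox (hA : IsClosed A) : IsClosed (innerApprox A ε) :=
  hA.inter (isClosed_le continuous_const (continuous_infDist_pt _))

lemma eventually_mem_innerApprox (hc : Aᶜ.Nonempty) (hx : x ∈ interior A) :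
    ∀ᶠ ε in 𝓝[>] (0 : ℝ), x ∈ innerApprox A ε := by
  have hpos : 0 < infDist x Aᶜ := by
    refine (infDist_pos_iff_notMem_closure hc).1 ?_
    rwa [closure_compl, notMem_compl_iff]
  filter_upwards [Ioc_mem_nhdsGT hpos] with ε hε
  exact ⟨interior_subset hx, hε.2⟩

lemma payoff_of_mem_innerApprox (hx : x ∈ innerApprox A ε) : payoff A ε x = 1 := by
  simp [payoff, infDist_zero_of_mem hx]

lemma payoff_of_notMem (hε : 0 < ε) (hne : (innerApprox A ε).Nonempty) (hx : x ∉ A) :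
    payoff A ε x = 0 := by
  have h : ε ≤ infDist x (innerApprox A ε) := (le_infDist hne).2 fun y hy =>
    hy.2.trans (dist_comm x y ▸ infDist_le_dist_of_mem hx)
  exact max_eq_right (sub_nonpos.2 ((one_le_div hε).2 h))

end InnerApprox

/-- Pathwise convergence underlying Theorem 5.1 (`V = lim_{ε↓0} V_ε`): with
`τ_ε = min (τ_{A_ε ∪ B}, T)` and `τ̄ = min (τ_{A ∪ B}, T)`, on paths that enter the
interior of `A` whenever they enter `A` and whose entry time into `A` is not exactly `T`,
the stopped payoff `ℓ_ε(ω(τ_ε))` converges to `1_A(ω(τ̄))` as `ε → 0⁺`. -/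
theorem stopped_payoff_tendsto {n : ℕ} (A B : Set (EuclideanSpace ℝ (Fin n)))
    (hA : IsClosed A) (hB : IsClosed B) (hAB : Disjoint A B)
    (hc : Aᶜ.Nonempty) (hint : (interior A).Nonempty)
    (ω : ℝ≥0 → EuclideanSpace ℝ (Fin n)) (hω : Continuous ω)
    (t T : ℝ≥0) (htT : t ≤ T)
    (hreg : entryTime ω t (interior A) = entryTime ω t A)
    (hne : entryTime ω t A ≠ (T : ℝ≥0∞)) :
    Filter.Tendsto
      (fun ε : ℝ =>
        payoff A ε (ω (min (entryTime ω t (innerApprox A ε ∪ B)) (T : ℝ≥0∞)).toNNReal))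
      (nhdsWithin 0 (Set.Ioi 0))
      (nhds (A.indicator (fun _ => (1 : ℝ))
        (ω (min (entryTime ω t (A ∪ B)) (T : ℝ≥0∞)).toNNReal))) := by
  have hlt_or : entryTime ω t A < min (entryTime ω t B) T ∨
      min (entryTime ω t B) T < entryTime ω t A := by
    refine lt_or_gt_of_ne fun h => ?_
    have hfin : entryTime ω t A ≠ ∞ := ne_top_of_le_ne_top ENNReal.coe_ne_top
      (h.trans_le (min_le_right _ _))
    rcases min_choice (entryTime ω t B) (T : ℝ≥0∞) with hm | hm
    · have hAB' := h.trans hm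
      refine hAB.ne_of_mem (mem_of_entryTime_ne_top hω hA hfin)
        (mem_of_entryTime_ne_top hω hB (hAB' ▸ hfin)) ?_
      rw [hAB']
    · exact hne (h.trans hm)
  refine tendsto_nhds_of_eventually_eq ?_
  rcases hlt_or with hlt | hlt
  · have hmem : ω (min (entryTime ω t (A ∪ B)) (T : ℝ≥0∞)).toNNReal ∈ A := by
      rw [entryTime_union, min_assoc, min_eq_left hlt.le]
      exact mem_of_entryTime_ne_top hω hA hlt.ne_top
    obtain ⟨s, hts, hs, hsm⟩ := exists_mem_of_entryTime_lt (hreg.trans_lt hlt)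
    filter_upwards [eventually_mem_innerApprox hc hs] with ε hε
    have hlt' := (entryTime_le hts hε).trans_lt hsm
    rw [indicator_of_mem hmem, entryTime_union, min_assoc, min_eq_left hlt'.le]
    exact payoff_of_mem_innerApprox
      (mem_of_entryTime_ne_top hω (isClosed_innerApprox hA) hlt'.ne_top)
  · have hfin : min (entryTime ω t B) (T : ℝ≥0∞) ≠ ∞ := hlt.ne_top
    have hnot : ω (min (entryTime ω t B) (T : ℝ≥0∞)).toNNReal ∉ A := fun hmem => by
      have hle : t ≤ (min (entryTime ω t B) (T : ℝ≥0∞)).toNNReal :=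
        ENNReal.le_toNNReal_of_coe_le
          (le_min le_entryTime_self (ENNReal.coe_le_coe.2 htT)) hfin
      have := entryTime_le hle hmem
      rw [ENNReal.coe_toNNReal hfin] at this
      exact this.not_gt hlt
    obtain ⟨y, hy⟩ := hint
    filter_upwards [eventually_mem_innerApprox hc hy, self_mem_nhdsWithin] with ε hyε hε
    have hle := hlt.le.trans (entryTime_anti (ω := ω) (t := t) (innerApprox_subset (ε := ε)))
    rw [entryTime_union, entryTime_union, min_assoc, min_assoc, min_eq_right hle,
      min_eq_right hlt.le, indicator_of_notMem hnot]
    exact payoff_of_notMem hε ⟨y, hyε⟩ hnot
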